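/- arXiv:2412.01756 — 3 statements merged into one kernel-verified Lean document; each statement's English description precedes it below -/
import Mathlib

section
/- Let Φ denote the standard normal CDF, μ > 0, ε ≥ 0, and δ(ε, μ) = Φ(−ε/μ + μ/2) − e^ε Φ(−ε/μ − μ/2). Let P = N(μ, 1) and Q = N(0, 1). Then sup over measurable sets S ⊆ ℝ of (P(S) − e^ε Q(S)) equals δ(ε, μ), and the supremum is attained at the threshold set S* = [ε/μ + μ/2, ∞), for which P(S*) = Φ(−ε/μ + μ/2) and Q(S*) = Φ(−ε/μ − μ/2). -/
open MeasureTheory ProbabilityTheory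

/-- The standard normal CDF `Φ`. -/
noncomputable def stdNormalCDF (x : ℝ) : ℝ :=
  ((gaussianReal 0 1) (Set.Iic x)).toReal

/-- The upper tail of `N(m,1)` at `t` is `Φ(m - t)`. -/
theorem gaussianReal_Ici_toReal (m t : ℝ) :
    ((gaussianReal m 1) (Set.Ici t)).toReal = stdNormalCDF (m - t) := by
  have hmap : (gaussianReal m 1).map (fun x ↦ m - x) = gaussianReal 0 1 := by
    simpa using gaussianReal_map_const_sub (μ := m) (v := 1) m
  rw [stdNormalCDF, ← hmap, Measure.map_apply (by fun_prop) measurableSet_Iic]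
  congr 2
  ext x
  simp

/-- The measure of a set under a Gaussian with unit variance, as the integral of the density. -/
theorem gaussianReal_one_toReal (m : ℝ) (S : Set ℝ) :
    ((gaussianReal m 1) S).toReal = ∫ x in S, gaussianPDFReal m 1 x := by
  rw [gaussianReal_apply_eq_integral m one_ne_zero,
    ENNReal.toReal_ofReal (integral_nonneg fun x ↦ gaussianPDFReal_nonneg m 1 x)]

/-- The hockey-stick gap of a set is the integral of the gap of the densities. -/
theorem gaussianReal_sub_mul_eq_setIntegral (m c : ℝ) (S : Set ℝ) :
    ((gaussianReal m 1) S).toReal - c * ((gaussianReal 0 1) S).toReal =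
      ∫ x in S, (gaussianPDFReal m 1 x - c * gaussianPDFReal 0 1 x) := by
  rw [gaussianReal_one_toReal, gaussianReal_one_toReal,
    integral_sub (integrable_gaussianPDFReal m 1).integrableOn
      ((integrable_gaussianPDFReal 0 1).const_mul c).integrableOn, integral_const_mul]

/-- The likelihood ratio of `N(m,1)` to `N(0,1)` is at least `e^ε` exactly on `[ε/m + m/2, ∞)`. -/
theorem setOf_gaussianPDFReal_sub_nonneg {m : ℝ} (hm : 0 < m) (ε : ℝ) :
    {x | 0 ≤ gaussianPDFReal m 1 x - Real.exp ε * gaussianPDFReal 0 1 x} =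
      Set.Ici (ε / m + m / 2) := by
  ext x
  have hratio : gaussianPDFReal m 1 x =
      Real.exp (m * x - m ^ 2 / 2) * gaussianPDFReal 0 1 x := by
    simp only [gaussianPDFReal, NNReal.coe_one]
    rw [mul_left_comm, ← Real.exp_add]
    ring_nf
  have hthreshold : ε / m + m / 2 = (ε + m ^ 2 / 2) / m := by field_simp
  rw [Set.mem_ofPred_eq, Set.mem_Ici, sub_nonneg, hratio,
    mul_le_mul_iff_left₀ (gaussianPDFReal_pos 0 1 x one_ne_zero), Real.exp_le_exp,
    hthreshold, div_le_iff₀ hm, mul_comm x m, le_sub_iff_add_le]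

/-- The hockey-stick divergence between `N(μ,1)` and `N(0,1)` at parameter `e^ε`
equals `δ(ε,μ) = Φ(-ε/μ + μ/2) - e^ε Φ(-ε/μ - μ/2)`, and the supremum is
attained at the threshold set `S* = [ε/μ + μ/2, ∞)`, for which
`P(S*) = Φ(-ε/μ + μ/2)` and `Q(S*) = Φ(-ε/μ - μ/2)`. -/
theorem gaussian_hockey_stick_divergence (μ : ℝ) (hμ : 0 < μ) (ε : ℝ) (hε : 0 ≤ ε) :
    IsGreatest
      {d : ℝ | ∃ S : Set ℝ, MeasurableSet S ∧
        d = ((gaussianReal μ 1) S).toReal - Real.exp ε * ((gaussianReal 0 1) S).toReal}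
      (stdNormalCDF (-ε / μ + μ / 2) - Real.exp ε * stdNormalCDF (-ε / μ - μ / 2)) ∧
    ((gaussianReal μ 1) (Set.Ici (ε / μ + μ / 2))).toReal = stdNormalCDF (-ε / μ + μ / 2) ∧
    ((gaussianReal 0 1) (Set.Ici (ε / μ + μ / 2))).toReal = stdNormalCDF (-ε / μ - μ / 2) := by
  have hP : ((gaussianReal μ 1) (Set.Ici (ε / μ + μ / 2))).toReal =
      stdNormalCDF (-ε / μ + μ / 2) := by
    rw [gaussianReal_Ici_toReal]
    ring_nf
  have hQ : ((gaussianReal 0 1) (Set.Ici (ε / μ + μ / 2))).toReal =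
      stdNormalCDF (-ε / μ - μ / 2) := by
    rw [gaussianReal_Ici_toReal]
    ring_nf
  refine ⟨⟨⟨Set.Ici (ε / μ + μ / 2), measurableSet_Ici, by rw [hP, hQ]⟩, ?_⟩, hP, hQ⟩
  rintro d ⟨S, hS, rfl⟩
  rw [← hP, ← hQ, gaussianReal_sub_mul_eq_setIntegral, gaussianReal_sub_mul_eq_setIntegral,
    ← setOf_gaussianPDFReal_sub_nonneg hμ ε]
  refine setIntegral_le_nonneg hS ?_ ?_
  · exact ((measurable_gaussianPDFReal μ 1).sub
      ((measurable_gaussianPDFReal 0 1).const_mul _)).stronglyMeasurable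
  · exact (integrable_gaussianPDFReal μ 1).sub ((integrable_gaussianPDFReal 0 1).const_mul _)
end

section
/- Let Φ denote the standard normal CDF and φ the standard normal density, and fix ε ≥ 0. Define δ(μ) = Φ(−ε/μ + μ/2) − e^ε Φ(−ε/μ − μ/2) for μ > 0. Then δ is differentiable in μ with dδ/dμ = φ(−ε/μ + μ/2) > 0; in particular δ is strictly increasing in μ. -/
open MeasureTheory ProbabilityTheory

/-- The standard normal density `φ(x) = (2π)^{-1/2} e^{-x²/2}`. -/
noncomputable def stdNormalPDF (x : ℝ) : ℝ :=
  (Real.sqrt (2 * Real.pi))⁻¹ * Real.exp (-x ^ 2 / 2)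

theorem stdNormalPDF_pos (x : ℝ) : 0 < stdNormalPDF x := by
  unfold stdNormalPDF
  positivity

theorem continuous_stdNormalPDF : Continuous stdNormalPDF := by
  unfold stdNormalPDF
  fun_prop

theorem gaussianPDFReal_zero_one : gaussianPDFReal 0 1 = stdNormalPDF := by
  ext x
  simp [gaussianPDFReal, stdNormalPDF]

theorem integrable_stdNormalPDF : Integrable stdNormalPDF := by
  rw [← gaussianPDFReal_zero_one]
  exact integrable_gaussianPDFReal 0 1

theorem stdNormalCDF_eq_integral (x : ℝ) :
    stdNormalCDF x = ∫ t in Set.Iic x, stdNormalPDF t := by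
  rw [stdNormalCDF, gaussianReal_apply_eq_integral 0 one_ne_zero, gaussianPDFReal_zero_one,
    ENNReal.toReal_ofReal (integral_nonneg fun t => (stdNormalPDF_pos t).le)]

theorem hasDerivAt_stdNormalCDF (x : ℝ) : HasDerivAt stdNormalCDF (stdNormalPDF x) x := by
  have h : stdNormalCDF =
      fun y => (∫ t in (0 : ℝ)..y, stdNormalPDF t) + stdNormalCDF 0 := by
    ext y
    rw [stdNormalCDF_eq_integral, stdNormalCDF_eq_integral, ← sub_eq_iff_eq_add]
    exact intervalIntegral.integral_Iic_sub_Iic integrable_stdNormalPDF.integrableOn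
      integrable_stdNormalPDF.integrableOn
  rw [h]
  exact (continuous_stdNormalPDF.integral_hasStrictDerivAt 0 x).hasDerivAt.add_const _

/-- The likelihood-ratio identity `φ(-ε/μ + μ/2) = e^ε φ(-ε/μ - μ/2)`. -/
theorem exp_mul_stdNormalPDF (ε : ℝ) {μ : ℝ} (hμ : μ ≠ 0) :
    Real.exp ε * stdNormalPDF (-ε / μ - μ / 2) = stdNormalPDF (-ε / μ + μ / 2) := by
  unfold stdNormalPDF
  rw [mul_left_comm, ← Real.exp_add]
  congr 2
  field_simp
  ring

theorem hasDerivAt_privacy_curve (ε : ℝ) {μ : ℝ} (hμ : μ ≠ 0) :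
    HasDerivAt
      (fun μ : ℝ => stdNormalCDF (-ε / μ + μ / 2) -
        Real.exp ε * stdNormalCDF (-ε / μ - μ / 2))
      (stdNormalPDF (-ε / μ + μ / 2)) μ := by
  have hdiv : HasDerivAt (fun μ : ℝ => -ε / μ) (ε / μ ^ 2) μ := by
    simpa [div_eq_mul_inv] using (hasDerivAt_inv hμ).const_mul (-ε)
  have hhalf : HasDerivAt (fun μ : ℝ => μ / 2) (1 / 2) μ := (hasDerivAt_id μ).div_const 2
  have hplus := (hasDerivAt_stdNormalCDF (-ε / μ + μ / 2)).comp μ (hdiv.add hhalf)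
  have hminus := (hasDerivAt_stdNormalCDF (-ε / μ - μ / 2)).comp μ (hdiv.sub hhalf)
  refine (hplus.sub (hminus.const_mul (Real.exp ε))).congr_deriv ?_
  rw [← mul_assoc, exp_mul_stdNormalPDF ε hμ]
  ring

/-- For fixed `ε ≥ 0`, the privacy curve
`δ(μ) = Φ(-ε/μ + μ/2) - e^ε Φ(-ε/μ - μ/2)` is differentiable in `μ > 0` with
strictly positive derivative `φ(-ε/μ + μ/2)`; in particular it is strictly
increasing in `μ`. -/
theorem privacy_curve_strictMono_in_mu (ε : ℝ) (hε : 0 ≤ ε) :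
    (∀ μ ∈ Set.Ioi (0 : ℝ),
      HasDerivAt
        (fun μ : ℝ => stdNormalCDF (-ε / μ + μ / 2) -
          Real.exp ε * stdNormalCDF (-ε / μ - μ / 2))
        (stdNormalPDF (-ε / μ + μ / 2)) μ ∧
      0 < stdNormalPDF (-ε / μ + μ / 2)) ∧
    StrictMonoOn
      (fun μ : ℝ => stdNormalCDF (-ε / μ + μ / 2) -
        Real.exp ε * stdNormalCDF (-ε / μ - μ / 2))
      (Set.Ioi 0) := by
  have hderiv : ∀ μ ∈ Set.Ioi (0 : ℝ), _ := fun μ hμ =>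
    hasDerivAt_privacy_curve ε (ne_of_gt hμ)
  refine ⟨fun μ hμ => ⟨hderiv μ hμ, stdNormalPDF_pos _⟩, ?_⟩
  refine strictMonoOn_of_deriv_pos (convex_Ioi 0)
    (fun μ hμ => (hderiv μ hμ).continuousAt.continuousWithinAt) fun μ hμ => ?_
  rw [interior_Ioi] at hμ
  rw [(hderiv μ hμ).deriv]
  exact stdNormalPDF_pos _
end

section
/- Let Φ denote the standard normal CDF and μ > 0. Define δ(ε) = Φ(−ε/μ + μ/2) − e^ε Φ(−ε/μ − μ/2). Then 0 < δ(ε) < 1 for every ε ≥ 0, δ(0) = 2Φ(μ/2) − 1, and δ(ε) → 0 as ε → ∞. -/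
open MeasureTheory ProbabilityTheory Filter

lemma stdNormalCDF_eq_setIntegral (x : ℝ) :
    stdNormalCDF x = ∫ t in Set.Iic x, gaussianPDFReal 0 1 t := by
  rw [stdNormalCDF, gaussianReal_apply_eq_integral 0 one_ne_zero, ENNReal.toReal_ofReal]
  exact integral_nonneg fun t => gaussianPDFReal_nonneg 0 1 t

lemma stdNormalCDF_add_eq_setIntegral (x y : ℝ) :
    stdNormalCDF (x + y) = ∫ t in Set.Iic x, gaussianPDFReal 0 1 (t + y) := by
  have h : (gaussianReal 0 1).map (fun t => t - y) (Set.Iic x) =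
      gaussianReal 0 1 (Set.Iic (x + y)) := by
    rw [Measure.map_apply (by fun_prop) measurableSet_Iic]
    congr 1
    ext t
    simp
  rw [stdNormalCDF, ← h, gaussianReal_map_sub_const,
    gaussianReal_apply_eq_integral _ one_ne_zero, ENNReal.toReal_ofReal]
  · simp only [gaussianPDFReal_add]
  · exact integral_nonneg fun t => gaussianPDFReal_nonneg _ 1 t

lemma stdNormalCDF_nonneg (x : ℝ) : 0 ≤ stdNormalCDF x := ENNReal.toReal_nonneg

lemma stdNormalCDF_neg (x : ℝ) : stdNormalCDF (-x) = 1 - stdNormalCDF x := by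
  have := nullSingletonClass_gaussianReal (μ := 0) (v := 1) one_ne_zero
  have h : (gaussianReal 0 1).map (fun t => -t) (Set.Iic (-x)) =
      gaussianReal 0 1 (Set.Iic x)ᶜ := by
    rw [Measure.map_apply measurable_neg measurableSet_Iic, Set.compl_Iic,
      measure_congr Ioi_ae_eq_Ici]
    congr 1
    ext t
    simp
  rw [gaussianReal_map_neg, neg_zero] at h
  rw [stdNormalCDF, h]
  exact probReal_compl_eq_one_sub measurableSet_Iic

lemma stdNormalCDF_pos (x : ℝ) : 0 < stdNormalCDF x := by
  refine ENNReal.toReal_pos (fun h => ?_) (measure_ne_top _ _)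
  have := gaussianReal_absolutelyContinuous' 0 (v := 1) one_ne_zero h
  simp at this

lemma stdNormalCDF_lt_one (x : ℝ) : stdNormalCDF x < 1 := by
  linarith [stdNormalCDF_neg x, stdNormalCDF_pos (-x)]

lemma tendsto_stdNormalCDF_atBot : Tendsto stdNormalCDF atBot (nhds 0) := by
  have h : stdNormalCDF = cdf (gaussianReal 0 1) := by
    ext x
    exact (cdf_eq_real _ x).symm
  rw [h]
  exact tendsto_cdf_atBot _

/-- The likelihood ratio of the normal densities with means `-μ` and `0` exceeds `e ^ ε` to the
left of `-ε / μ - μ / 2`. -/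
lemma exp_mul_gaussianPDFReal_lt {μ ε t : ℝ} (hμ : 0 < μ) (ht : t < -ε / μ - μ / 2) :
    Real.exp ε * gaussianPDFReal 0 1 t < gaussianPDFReal 0 1 (t + μ) := by
  simp only [gaussianPDFReal_def, NNReal.coe_one, sub_zero, mul_one]
  rw [mul_left_comm, ← Real.exp_add]
  refine mul_lt_mul_of_pos_left (Real.exp_lt_exp.mpr ?_) (by positivity)
  have h : (t + μ / 2) * μ < -ε := (lt_div_iff₀ hμ).mp (by linarith)
  nlinarith

lemma exp_mul_stdNormalCDF_lt {μ : ℝ} (hμ : 0 < μ) (ε : ℝ) :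
    Real.exp ε * stdNormalCDF (-ε / μ - μ / 2) < stdNormalCDF (-ε / μ + μ / 2) := by
  set b := -ε / μ - μ / 2 with hb
  have hb' : -ε / μ + μ / 2 = b + μ := by rw [hb]; ring
  have hf : Integrable (gaussianPDFReal 0 1) := integrable_gaussianPDFReal 0 1
  rw [hb', stdNormalCDF_add_eq_setIntegral, stdNormalCDF_eq_setIntegral, ← integral_const_mul,
    integral_Iic_eq_integral_Iio, integral_Iic_eq_integral_Iio, ← sub_pos,
    ← integral_sub (hf.comp_add_right μ).integrableOn (hf.const_mul _).integrableOn]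
  have hpos : ∀ t ∈ Set.Iio b,
      0 < gaussianPDFReal 0 1 (t + μ) - Real.exp ε * gaussianPDFReal 0 1 t :=
    fun t ht => sub_pos.mpr (exp_mul_gaussianPDFReal_lt hμ ht)
  rw [setIntegral_pos_iff_support_of_nonneg_ae]
  · have hsupp : Set.Iio b ⊆ Function.support fun t =>
        gaussianPDFReal 0 1 (t + μ) - Real.exp ε * gaussianPDFReal 0 1 t :=
      fun t ht => (hpos t ht).ne'
    rw [Set.inter_eq_self_of_subset_right hsupp]
    simp
  · exact ae_restrict_of_forall_mem measurableSet_Iio fun t ht => (hpos t ht).le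
  · exact ((hf.comp_add_right μ).sub (hf.const_mul _)).integrableOn

/-- For fixed `μ > 0`, the privacy curve
`δ(ε) = Φ(-ε/μ + μ/2) - e^ε Φ(-ε/μ - μ/2)` satisfies `0 < δ(ε) < 1` for every
`ε ≥ 0`, `δ(0) = 2Φ(μ/2) - 1`, and `δ(ε) → 0` as `ε → ∞`. -/
theorem privacy_curve_range_and_limits (μ : ℝ) (hμ : 0 < μ) :
    (∀ ε : ℝ, 0 ≤ ε →
      0 < stdNormalCDF (-ε / μ + μ / 2) - Real.exp ε * stdNormalCDF (-ε / μ - μ / 2) ∧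
      stdNormalCDF (-ε / μ + μ / 2) - Real.exp ε * stdNormalCDF (-ε / μ - μ / 2) < 1) ∧
    stdNormalCDF (-0 / μ + μ / 2) - Real.exp 0 * stdNormalCDF (-0 / μ - μ / 2) =
      2 * stdNormalCDF (μ / 2) - 1 ∧
    Tendsto
      (fun ε : ℝ => stdNormalCDF (-ε / μ + μ / 2) -
        Real.exp ε * stdNormalCDF (-ε / μ - μ / 2))
      atTop (nhds 0) := by
  have hle (ε : ℝ) : stdNormalCDF (-ε / μ + μ / 2) -
      Real.exp ε * stdNormalCDF (-ε / μ - μ / 2) ≤ stdNormalCDF (-ε / μ + μ / 2) :=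
    sub_le_self _ (mul_nonneg (Real.exp_pos ε).le (stdNormalCDF_nonneg _))
  refine ⟨fun ε _ => ⟨sub_pos.mpr (exp_mul_stdNormalCDF_lt hμ ε),
    (hle ε).trans_lt (stdNormalCDF_lt_one _)⟩, ?_, ?_⟩
  · rw [neg_zero, zero_div, zero_add, zero_sub, Real.exp_zero, one_mul, stdNormalCDF_neg]
    ring
  · refine squeeze_zero (fun ε => (sub_pos.mpr (exp_mul_stdNormalCDF_lt hμ ε)).le) hle
      (tendsto_stdNormalCDF_atBot.comp ?_)
    exact tendsto_atBot_add_const_right _ _ (tendsto_neg_atTop_atBot.atBot_div_const hμ)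
end
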